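/- Let l be an odd prime with l ≡ 3, 5, or 6 (mod 7), and let a ∈ 𝔽_l with a ≠ 0 and a ≠ 1728. Then the polynomial F(z,a) ∈ 𝔽_l[z] has at most 2 roots in 𝔽_l. -/

import Mathlib

open Polynomial

/-- `F(z,a) = (z²-3z+9)(z²-11z+25)³ - a·(z-8)` as a polynomial in `z` over `𝔽_l`. -/
noncomputable def Fza (l : ℕ) [Fact (Nat.Prime l)] (a : ZMod l) : Polynomial (ZMod l) :=
  (X ^ 2 - 3 * X + 9) * (X ^ 2 - 11 * X + 25) ^ 3 - C a * (X - 8)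

section helpers

variable {R : Type*} [CommRing R]

/-- Rational part of the cubic splitting the residual sextic. -/
def cubA (s m t : R) : R :=
    2*s^5*t^3 - 16*s^3*m*t^3 + 18*s*m^2*t^3 + 42*s^4*t^3 - 266*s^2*m*t^3 + 126*m^2*t^3 +
    336*s^3*t^3 - 1568*s*m*t^3 + 1218*s^2*t^3 - 3262*m*t^3 + 1820*s*t^3 + 686*t^3 + s^6*t^2 -
    8*s^4*m*t^2 + 9*s^2*m^2*t^2 + 49*s^5*t^2 - 357*s^3*m*t^2 + 315*s*m^2*t^2 + 756*s^4*t^2 -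
    4508*s^2*m*t^2 + 1764*m^2*t^2 + 5313*s^3*t^2 - 23583*s*m*t^2 + 17962*s^2*t^2 - 45668*m*t^2 +
    25823*s*t^2 + 9604*t^2 - s^7*t + 2*s^5*m*t - 3*s^3*m^2*t + 2*s*m^3*t - 21*s^6*t - 63*s^4*m*t +
    91*s^2*m^2*t - 14*m^3*t - 56*s^5*t - 2674*s^3*m*t + 2212*s*m^2*t + 1799*s^4*t - 30191*s^2*m*t +
    10696*m^2*t + 18858*s^3*t - 143682*s*m*t + 73549*s^2*t - 256760*m*t + 114758*s*t + 45178*t -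
    2*s^8 + 13*s^6*m - 29*s^4*m^2 + 22*s^2*m^3 - 70*s^7 + 350*s^5*m - 574*s^3*m^2 + 287*s*m^3 -
    1022*s^6 + 3514*s^4*m - 3682*s^2*m^2 + 840*m^3 - 7868*s^5 + 13461*s^3*m - 5642*s*m^2 -
    32795*s^4 - 13489*s^2*m + 15624*m^2 - 63847*s^3 - 244902*s*m - 11466*s^2 - 520968*m + 112357*s
    + 63504

/-- Part of that cubic along the square root of `-7`. -/
def cubB (s m t : R) : R :=
    -s^5*t^2 + 3*s*m^2*t^2 - 25*s^4*t^2 + s^2*m*t^2 + 21*m^2*t^2 - 248*s^3*t^2 - 8*s*m*t^2 -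
    1197*s^2*t^2 - 77*m*t^2 - 2730*s*t^2 - 2219*t^2 - s^6*t + 4*s^4*m*t - 5*s^2*m^2*t + 2*m^3*t -
    37*s^5*t + 93*s^3*m*t - 49*s*m^2*t - 548*s^4*t + 834*s^2*m*t - 144*m^2*t - 4165*s^3*t +
    3255*s*m*t - 16968*s^2*t + 4592*m*t - 34321*s*t - 25550*t - s^5*m + 3*s^3*m^2 - 2*s*m^3 - 4*s^6
    - 16*s^4*m + 44*s^2*m^2 - 11*m^3 - 130*s^5 - 58*s^3*m + 234*s*m^2 - 1750*s^4 + 301*s^2*m +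
    406*m^2 - 12369*s^3 + 2177*s*m - 47719*s^2 + 3066*m - 92974*s - 68061

/-- Cofactor of `relG` in the norm identity. -/
def cubH (s m t : R) : R :=
    64*s^4*t^4 - 144*s^2*m*t^4 + 784*s^3*t^4 - 1008*s*m*t^4 + 1680*s^2*t^4 - 13888*s*t^4 -
    54880*t^4 + 96*s^5*t^3 - 384*s^3*m*t^3 + 336*s*m^2*t^3 + 2688*s^4*t^3 - 7280*s^2*m*t^3 +
    2352*m^2*t^3 + 22064*s^3*t^3 - 36512*s*m*t^3 + 33152*s^2*t^3 - 27440*m*t^3 - 345856*s*t^3 -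
    1201872*t^3 + 60*s^6*t^2 - 208*s^4*m*t^2 + 68*s^2*m^2*t^2 + 112*m^3*t^2 + 2716*s^5*t^2 -
    8428*s^3*m*t^2 + 4312*s*m^2*t^2 + 42560*s^4*t^2 - 97748*s^2*m*t^2 + 22680*m^2*t^2 +
    274064*s^3*t^2 - 401072*s*m*t^2 + 416612*s^2*t^2 - 337848*m*t^2 - 2876496*s*t^2 - 9740024*t^2 +
    60*s^7*t - 328*s^5*m*t + 492*s^3*m^2*t - 224*s*m^3*t + 2548*s^6*t - 10668*s^4*m*t +
    9744*s^2*m^2*t - 1232*m^3*t + 46816*s^5*t - 147700*s^3*m*t + 76216*s*m^2*t + 454048*s^4*t -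
    1013320*s^2*m*t + 205520*m^2*t + 2282196*s^3*t - 3209752*s*m*t + 4188520*s^2*t - 3070928*m*t -
    8352344*s*t - 34276480*t + 32*s^8 - 220*s^6*m + 400*s^4*m^2 - 212*s^2*m^3 + 1428*s^7 -
    8092*s^5*m + 10696*s^3*m^2 - 3304*s*m^3 + 27972*s^6 - 126252*s^4*m + 109872*s^2*m^2 - 12488*m^3
    + 311136*s^5 - 1066520*s^3*m + 522088*s*m^2 + 2096612*s^4 - 5060216*s^2*m + 957264*m^2 +
    8261792*s^3 - 12329968*s*m + 15261540*s^2 - 10827824*m - 3647168*s - 43712312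

/-- Derivative of `cubA` in `t`. -/
def dcubA (s m t : R) : R :=
    6*s^5*t^2 - 48*s^3*m*t^2 + 54*s*m^2*t^2 + 126*s^4*t^2 - 798*s^2*m*t^2 + 378*m^2*t^2 +
    1008*s^3*t^2 - 4704*s*m*t^2 + 3654*s^2*t^2 - 9786*m*t^2 + 5460*s*t^2 + 2058*t^2 + 2*s^6*t -
    16*s^4*m*t + 18*s^2*m^2*t + 98*s^5*t - 714*s^3*m*t + 630*s*m^2*t + 1512*s^4*t - 9016*s^2*m*t +
    3528*m^2*t + 10626*s^3*t - 47166*s*m*t + 35924*s^2*t - 91336*m*t + 51646*s*t + 19208*t - s^7 +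
    2*s^5*m - 3*s^3*m^2 + 2*s*m^3 - 21*s^6 - 63*s^4*m + 91*s^2*m^2 - 14*m^3 - 56*s^5 - 2674*s^3*m +
    2212*s*m^2 + 1799*s^4 - 30191*s^2*m + 10696*m^2 + 18858*s^3 - 143682*s*m + 73549*s^2 - 256760*m
    + 114758*s + 45178

/-- Derivative of `cubB` in `t`. -/
def dcubB (s m t : R) : R :=
    -2*s^5*t + 6*s*m^2*t - 50*s^4*t + 2*s^2*m*t + 42*m^2*t - 496*s^3*t - 16*s*m*t - 2394*s^2*t -
    154*m*t - 5460*s*t - 4438*t - s^6 + 4*s^4*m - 5*s^2*m^2 + 2*m^3 - 37*s^5 + 93*s^3*m - 49*s*m^2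
    - 548*s^4 + 834*s^2*m - 144*m^2 - 4165*s^3 + 3255*s*m - 16968*s^2 + 4592*m - 34321*s - 25550

/-- Derivative of `cubH` in `t`. -/
def dcubH (s m t : R) : R :=
    256*s^4*t^3 - 576*s^2*m*t^3 + 3136*s^3*t^3 - 4032*s*m*t^3 + 6720*s^2*t^3 - 55552*s*t^3 -
    219520*t^3 + 288*s^5*t^2 - 1152*s^3*m*t^2 + 1008*s*m^2*t^2 + 8064*s^4*t^2 - 21840*s^2*m*t^2 +
    7056*m^2*t^2 + 66192*s^3*t^2 - 109536*s*m*t^2 + 99456*s^2*t^2 - 82320*m*t^2 - 1037568*s*t^2 -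
    3605616*t^2 + 120*s^6*t - 416*s^4*m*t + 136*s^2*m^2*t + 224*m^3*t + 5432*s^5*t - 16856*s^3*m*t
    + 8624*s*m^2*t + 85120*s^4*t - 195496*s^2*m*t + 45360*m^2*t + 548128*s^3*t - 802144*s*m*t +
    833224*s^2*t - 675696*m*t - 5752992*s*t - 19480048*t + 60*s^7 - 328*s^5*m + 492*s^3*m^2 -
    224*s*m^3 + 2548*s^6 - 10668*s^4*m + 9744*s^2*m^2 - 1232*m^3 + 46816*s^5 - 147700*s^3*m +
    76216*s*m^2 + 454048*s^4 - 1013320*s^2*m + 205520*m^2 + 2282196*s^3 - 3209752*s*m + 4188520*s^2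
    - 3070928*m - 8352344*s - 34276480

/-- The sextic left after removing two roots with sum `s` and product `m`. -/
def sext (s m t : R) : R :=
    t^6 + s*t^5 + 28*t^5 + s^2*t^4 - m*t^4 + 28*s*t^4 + 322*t^4 + s^3*t^3 - 2*s*m*t^3 + 28*s^2*t^3
    - 28*m*t^3 + 322*s*t^3 + 1904*t^3 + s^4*t^2 - 3*s^2*m*t^2 + m^2*t^2 + 28*s^3*t^2 - 56*s*m*t^2 +
    322*s^2*t^2 - 322*m*t^2 + 1904*s*t^2 + 5915*t^2 + s^5*t - 4*s^3*m*t + 3*s*m^2*t + 28*s^4*t -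
    84*s^2*m*t + 28*m^2*t + 322*s^3*t - 644*s*m*t + 1904*s^2*t - 1904*m*t + 5915*s*t + 8624*t + s^6
    - 5*s^4*m + 6*s^2*m^2 - m^3 + 28*s^5 - 112*s^3*m + 84*s*m^2 + 322*s^4 - 966*s^2*m + 322*m^2 +
    1904*s^3 - 3808*s*m + 5915*s^2 - 5915*m + 8624*s + 4018

/-- Derivative of `sext` in `t`. -/
def dsext (s m t : R) : R :=
    6*t^5 + 5*s*t^4 + 140*t^4 + 4*s^2*t^3 - 4*m*t^3 + 112*s*t^3 + 1288*t^3 + 3*s^3*t^2 - 6*s*m*t^2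
    + 84*s^2*t^2 - 84*m*t^2 + 966*s*t^2 + 5712*t^2 + 2*s^4*t - 6*s^2*m*t + 2*m^2*t + 56*s^3*t -
    112*s*m*t + 644*s^2*t - 644*m*t + 3808*s*t + 11830*t + s^5 - 4*s^3*m + 3*s*m^2 + 28*s^4 -
    84*s^2*m + 28*m^2 + 322*s^3 - 644*s*m + 1904*s^2 - 1904*m + 5915*s + 8624

/-- The relation between sum and product of two roots. -/
def relG (s m : R) : R :=
    -s^6*m + 5*s^4*m^2 - 6*s^2*m^3 + m^4 - 28*s^5*m + 112*s^3*m^2 - 84*s*m^3 - 322*s^4*m +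
    966*s^2*m^2 - 322*m^3 - 1904*s^3*m + 3808*s*m^2 - 5915*s^2*m + 5915*m^2 - 8624*s*m - 4018*m +
    49

/-- The value of `j` in terms of sum and product of two roots. -/
def relJ (s m : R) : R :=
    s^7 - 6*s^5*m + 10*s^3*m^2 - 4*s*m^3 + 28*s^6 - 140*s^4*m + 168*s^2*m^2 - 28*m^3 + 322*s^5 -
    1288*s^3*m + 966*s*m^2 + 1904*s^4 - 5712*s^2*m + 1904*m^2 + 5915*s^3 - 11830*s*m + 8624*s^2 -
    8624*m + 4018*s + 748

/-- The leading coefficient of `cubA`. -/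
def denD (s m : R) : R :=
    2*s^5 - 16*s^3*m + 18*s*m^2 + 42*s^4 - 266*s^2*m + 126*m^2 + 336*s^3 - 1568*s*m + 1218*s^2 -
    3262*m + 1820*s + 686

/-- Nullstellensatz cofactor. -/
def certU (s m : R) : R :=
    -12*s^8*m + 59*s^6*m^2 - 65*s^4*m^3 - 547*s^7*m + 2383*s^5*m^2 - 2152*s^3*m^3 - 10658*s^6*m +
    39688*s^4*m^2 - 26570*s^2*m^3 - 115564*s^5*m + 350527*s^3*m^2 - 145340*s*m^3 + 7*s^6 -
    757567*s^4*m + 1742260*s^2*m^2 - 298112*m^3 + 119*s^5 - 3036873*s^3*m + 4659172*s*m^2 + 728*s^4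
    - 7109844*s^2*m + 5302136*m^2 + 1687*s^3 - 8500604*s*m + 1526*s^2 - 3571736*m + 10192*s + 43512

/-- Nullstellensatz cofactor. -/
def certV (s m : R) : R :=
    -24*s^7 + 190*s^5*m - 196*s^3*m^2 - 56*s*m^3 - 926*s^6 + 6550*s^4*m - 5264*s^2*m^2 - 392*m^3 -
    14666*s^5 + 88948*s^3*m - 43932*s*m^2 - 122796*s^4 + 604404*s^2*m - 117600*m^2 - 577484*s^3 +
    2077556*s*m - 1475124*s^2 + 2910880*m - 1760500*s - 609448

/-- The numerator of `j` on the modular curve of level seven. -/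
def numP (t : R) : R := (t^2 + 13*t + 49) * (t^2 + 5*t + 1)^3

theorem numP_div (s m t : R) :
    numP t = (t^2 - s*t + m) * sext s m t + relJ s m * t + relG s m := by
  unfold numP sext relJ relG; ring

theorem norm_id (s m t : R) :
    denD s m ^ 2 * sext s m t =
      cubA s m t ^ 2 + 7 * (s^2 - 4*m) * cubB s m t ^ 2 + relG s m * cubH s m t := by
  unfold denD sext cubA cubB relG cubH; ring

theorem dnorm_id (s m t : R) :
    denD s m ^ 2 * dsext s m t =
      2 * cubA s m t * dcubA s m t + 14 * (s^2 - 4*m) * cubB s m t * dcubB s m t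
        + relG s m * dcubH s m t := by
  unfold denD dsext cubA cubB relG dcubA dcubB dcubH; ring

theorem den_id (s m : R) :
    14 * (m^2 + 5*s*m + s^2 + 23*m + 5*s + 1)^2 * (relJ s m - 1728) =
      certU s m * denD s m + certV s m * relG s m := by
  unfold relJ certU denD certV relG; ring

theorem numP_deriv (s m t : R) :
    t * ((2*t - s) * sext s m t + (t^2 - s*t + m) * dsext s m t + relJ s m) - numP t =
      7 * (t^2 + 5*t + 1)^2 * (t^4 + 14*t^3 + 63*t^2 + 70*t - 7) := by
  unfold numP sext dsext relJ; ring

theorem numP_sub (t : R) :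
    numP t - 1728 * t = (t^4 + 14*t^3 + 63*t^2 + 70*t - 7)^2 := by
  unfold numP; ring

end helpers

theorem no_three {k : Type*} [Field k] (h2 : (2 : k) ≠ 0) (h7 : (7 : k) ≠ 0)
    (hsq : ¬ IsSquare (-7 : k)) (a : k) (ha0 : a ≠ 0) (ha1 : a ≠ 1728) (x y t : k)
    (hxy : x ≠ y) (hxt : x ≠ t) (hyt : y ≠ t)
    (hx : numP x = a * x) (hy : numP y = a * y) (ht : numP t = a * t) : False := by
  have hnz : ∀ u : k, numP u = a * u → u ≠ 0 := by
    rintro u hu rfl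
    simp [numP] at hu
    apply h7
    have : (7 : k) * 7 = 0 := by linear_combination hu
    simpa using this
  have hg : ∀ u : k, numP u = a * u → u^2 + 5*u + 1 ≠ 0 := by
    intro u hu h
    have h3 : a * u = 0 := by rw [← hu, numP, h]; ring
    exact mul_ne_zero ha0 (hnz u hu) h3
  have hq : ∀ u : k, numP u = a * u → u^4 + 14*u^3 + 63*u^2 + 70*u - 7 ≠ 0 := by
    intro u hu h
    have h3 := numP_sub u
    rw [h, hu] at h3
    have h4 : (a - 1728) * u = 0 := by linear_combination h3
    exact mul_ne_zero (sub_ne_zero.2 ha1) (hnz u hu) h4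
  obtain ⟨s, hs⟩ : ∃ s, s = x + y := ⟨_, rfl⟩
  obtain ⟨m, hm⟩ : ∃ m, m = x * y := ⟨_, rfl⟩
  have ex := numP_div s m x
  have ey := numP_div s m y
  have et := numP_div s m t
  have qx : x^2 - s*x + m = 0 := by rw [hs, hm]; ring
  have qy : y^2 - s*y + m = 0 := by rw [hs, hm]; ring
  have qt : t^2 - s*t + m ≠ 0 := by
    have : t^2 - s*t + m = (x - t) * (y - t) := by rw [hs, hm]; ring
    rw [this]
    exact mul_ne_zero (sub_ne_zero.2 hxt) (sub_ne_zero.2 hyt)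
  rw [qx, hx] at ex
  rw [qy, hy] at ey
  have hJ : relJ s m = a := by
    have : (x - y) * (relJ s m - a) = 0 := by linear_combination ey - ex
    exact sub_eq_zero.1 ((mul_eq_zero.1 this).resolve_left (sub_ne_zero.2 hxy))
  have hG : relG s m = 0 := by rw [hJ] at ex; linear_combination -ex
  have hS : sext s m t = 0 := by
    rw [ht, hJ, hG] at et
    have : (t^2 - s*t + m) * sext s m t = 0 := by linear_combination -et
    exact (mul_eq_zero.1 this).resolve_left qt
  have hD : denD s m ≠ 0 := by
    intro h
    have h1 := den_id s m
    rw [h, hG, hJ] at h1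
    have h2' : (2 * 7 : k) * ((x^2 + 5*x + 1) * (y^2 + 5*y + 1))^2 * (a - 1728) = 0 := by
      rw [hs, hm] at h1
      linear_combination h1
    exact mul_ne_zero (mul_ne_zero (mul_ne_zero h2 h7)
      (pow_ne_zero _ (mul_ne_zero (hg x hx) (hg y hy)))) (sub_ne_zero.2 ha1) h2'
  have hN := norm_id s m t
  rw [hS, hG] at hN
  have hd : s^2 - 4*m = (x - y)^2 := by rw [hs, hm]; ring
  have hB : cubB s m t = 0 := by
    by_contra hB
    apply hsq
    have hne : (x - y) * cubB s m t ≠ 0 := mul_ne_zero (sub_ne_zero.2 hxy) hB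
    refine ⟨cubA s m t / ((x - y) * cubB s m t), ?_⟩
    rw [div_mul_div_comm, eq_div_iff (mul_ne_zero hne hne)]
    rw [hd] at hN
    linear_combination hN
  have hA : cubA s m t = 0 := by
    rw [hB] at hN
    have : cubA s m t ^ 2 = 0 := by linear_combination -hN
    exact pow_eq_zero_iff (two_ne_zero) |>.1 this
  have hN' := dnorm_id s m t
  rw [hA, hB, hG] at hN'
  have hS' : dsext s m t = 0 := by
    have : denD s m ^ 2 * dsext s m t = 0 := by linear_combination hN'
    exact (mul_eq_zero.1 this).resolve_left (pow_ne_zero _ hD)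
  have hP := numP_deriv s m t
  rw [hS, hS', hJ, ht] at hP
  have : 7 * (t^2 + 5*t + 1)^2 * (t^4 + 14*t^3 + 63*t^2 + 70*t - 7) = 0 := by
    linear_combination -hP
  exact mul_ne_zero (mul_ne_zero h7 (pow_ne_zero _ (hg t ht))) (hq t ht) this

theorem neg_seven_nonsquare (l : ℕ) [Fact (Nat.Prime l)] (hl2 : l ≠ 2)
    (h7 : l % 7 = 3 ∨ l % 7 = 5 ∨ l % 7 = 6) : ¬ IsSquare (-7 : ZMod l) := by
  have d3 : ¬ IsSquare ((3 : ℕ) : ZMod 7) := by decide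
  have d5 : ¬ IsSquare ((5 : ℕ) : ZMod 7) := by decide
  have d6 : ¬ IsSquare ((6 : ℕ) : ZMod 7) := by decide
  have : Fact (Nat.Prime 7) := ⟨by norm_num⟩
  have hl7 : l ≠ 7 := by rintro rfl; simp at h7
  have hnl : ¬ IsSquare ((l : ℕ) : ZMod 7) := by
    rw [← ZMod.natCast_mod l 7]
    rcases h7 with h | h | h <;> rw [h] <;> assumption
  have hodd : l % 2 = 1 := (Nat.Prime.eq_two_or_odd Fact.out).resolve_left hl2
  have h4 : l % 4 = 1 ∨ l % 4 = 3 := by omega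
  intro hsq
  rcases h4 with h4 | h4
  · have hm1 : IsSquare (-1 : ZMod l) := ZMod.exists_sq_eq_neg_one_iff.2 (by omega)
    have : IsSquare ((7 : ℕ) : ZMod l) := by
      have := hm1.mul hsq
      simpa using this
    exact hnl ((ZMod.exists_sq_eq_prime_iff_of_mod_four_eq_one h4 (by norm_num)).1 this)
  · have h7' : IsSquare ((7 : ℕ) : ZMod l) := by
      rw [ZMod.exists_sq_eq_prime_iff_of_mod_four_eq_three h4 (by norm_num) hl7]
      exact hnl
    have h70 : ((7 : ℕ) : ZMod l) ≠ 0 := by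
      rw [Ne, ZMod.natCast_eq_zero_iff]
      intro h
      exact hl7 ((Nat.prime_dvd_prime_iff_eq Fact.out (by norm_num)).1 h)
    have : IsSquare (-1 : ZMod l) := by
      have := hsq.div h7'
      have h3 : (-7 : ZMod l) / ((7 : ℕ) : ZMod l) = -1 := by
        rw [div_eq_iff h70]; push_cast; ring
      rwa [h3] at this
    exact ZMod.exists_sq_eq_neg_one_iff.1 this h4

/-- For an odd prime `l ≡ 3, 5, 6 (mod 7)` and `a ∈ 𝔽_l` with `a ≠ 0, 1728`,
the polynomial `F(z,a)` has at most `2` roots in `𝔽_l`. -/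
theorem Fza_at_most_two_roots (l : ℕ) [Fact (Nat.Prime l)] (hl2 : l ≠ 2)
    (h7 : l % 7 = 3 ∨ l % 7 = 5 ∨ l % 7 = 6)
    (a : ZMod l) (ha0 : a ≠ 0) (ha1728 : a ≠ 1728) :
    (Fza l a).roots.toFinset.card ≤ 2 := by
  have hl7 : l ≠ 7 := by rintro rfl; simp at h7
  have c2 : (2 : ZMod l) ≠ 0 := by
    have : ((2 : ℕ) : ZMod l) ≠ 0 := by
      rw [Ne, ZMod.natCast_eq_zero_iff]
      intro h
      exact hl2 ((Nat.prime_dvd_prime_iff_eq Fact.out (by norm_num)).1 h)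
    exact_mod_cast this
  have c7 : (7 : ZMod l) ≠ 0 := by
    have : ((7 : ℕ) : ZMod l) ≠ 0 := by
      rw [Ne, ZMod.natCast_eq_zero_iff]
      intro h
      exact hl7 ((Nat.prime_dvd_prime_iff_eq Fact.out (by norm_num)).1 h)
    exact_mod_cast this
  by_contra hc
  obtain ⟨x, y, t, hx, hy, ht, hxy, hxt, hyt⟩ := Finset.two_lt_card_iff.1 (not_le.1 hc)
  have key : ∀ u, u ∈ (Fza l a).roots.toFinset → numP (u - 8) = a * (u - 8) := by
    intro u hu
    have h1 := (mem_roots'.1 (Multiset.mem_toFinset.1 hu)).2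
    simp [Fza, IsRoot.def] at h1
    unfold numP
    linear_combination h1
  exact no_three c2 c7 (neg_seven_nonsquare l hl2 h7) a ha0 ha1728 (x - 8) (y - 8) (t - 8)
    (fun h => hxy (sub_left_injective h)) (fun h => hxt (sub_left_injective h))
    (fun h => hyt (sub_left_injective h)) (key x hx) (key y hy) (key t ht)
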